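/- Fix an integer K ≥ 1, a real a > 0, and a real s with 0 < s < K. Then there exists exactly one pair of reals (ρ_V, ρ_R) with ρ_V ≥ 0 and 0 ≤ ρ_R < a such that f(ρ_V,ρ_R) = 0 and s̃(ρ_V,ρ_R) = s. -/

import Mathlib

open Finset

/-- Partition function `Z(ρ_V, ρ_R) = Σ_{k+l ≤ K} ρ_V^k ρ_R^l / l!`. -/
noncomputable def Z (K : ℕ) (x r : ℝ) : ℝ :=
  ∑ k ∈ Finset.range (K + 1), ∑ l ∈ Finset.range (K + 1 - k),
    x ^ k * r ^ l / (Nat.factorial l : ℝ)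

/-- Stationary probability `π_{k,l}`. -/
noncomputable def piP (K : ℕ) (x r : ℝ) (k l : ℕ) : ℝ :=
  x ^ k * r ^ l / ((Nat.factorial l : ℝ) * Z K x r)

/-- `π_{0,·}` : probability of an empty station (no vehicles). -/
noncomputable def piZero (K : ℕ) (x r : ℝ) : ℝ :=
  ∑ l ∈ Finset.range (K + 1), piP K x r 0 l

/-- `π_S` : probability of a saturated station. -/
noncomputable def piSat (K : ℕ) (x r : ℝ) : ℝ :=
  ∑ k ∈ Finset.range (K + 1), piP K x r k (K - k)

/-- Mean occupancy `s̃(ρ_V,ρ_R)`. -/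
noncomputable def sTilde (K : ℕ) (x r : ℝ) : ℝ :=
  (∑ k ∈ Finset.range (K + 1), ∑ l ∈ Finset.range (K + 1 - k),
    ((k : ℝ) + (l : ℝ)) * (x ^ k * r ^ l / (Nat.factorial l : ℝ))) / Z K x r

/-- `f(ρ_V,ρ_R) = (a − ρ_R)·Z(ρ_V,ρ_R) − a·Σ_{l=0}^K ρ_R^l/l!`. -/
noncomputable def fEq (K : ℕ) (a x r : ℝ) : ℝ :=
  (a - r) * Z K x r - a * ∑ l ∈ Finset.range (K + 1), r ^ l / (Nat.factorial l : ℝ)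

/-- Proportion of problematic stations `P_b`. -/
noncomputable def Pb (K : ℕ) (x r : ℝ) : ℝ :=
  piZero K x r + piSat K x r - piP K x r 0 K

/-- Upper bound `P_b^+`. -/
noncomputable def PbPlus (K : ℕ) (x r : ℝ) : ℝ :=
  piZero K x r + piSat K x r

/-- Total weight of the states `(k, l)` with `k + l = n`. -/
noncomputable def levelWeight (x r : ℝ) (n : ℕ) : ℝ :=
  ∑ l ∈ range (n + 1), x ^ (n - l) * r ^ l / (Nat.factorial l : ℝ)

/-- Truncated exponential series. -/
noncomputable def truncExp (n : ℕ) (r : ℝ) : ℝ :=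
  ∑ l ∈ range (n + 1), r ^ l / (Nat.factorial l : ℝ)

lemma sum_triangle_eq_sum_levels (K : ℕ) (F : ℕ → ℕ → ℝ) :
    ∑ k ∈ range (K + 1), ∑ l ∈ range (K + 1 - k), F k l =
      ∑ n ∈ range (K + 1), ∑ l ∈ range (n + 1), F (n - l) l := by
  rw [sum_sigma', sum_sigma']
  refine sum_bij' (fun p _ => ⟨p.1 + p.2, p.2⟩) (fun p _ => ⟨p.1 - p.2, p.2⟩) ?_ ?_ ?_ ?_ ?_
  · rintro ⟨k, l⟩ h
    simp only [mem_sigma, mem_range] at h ⊢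
    omega
  · rintro ⟨n, l⟩ h
    simp only [mem_sigma, mem_range] at h ⊢
    omega
  · rintro ⟨k, l⟩ h
    simp
  · rintro ⟨n, l⟩ h
    simp only [mem_sigma, mem_range] at h
    simp only [Sigma.mk.injEq, heq_eq_eq, and_true]
    omega
  · rintro ⟨k, l⟩ h
    simp

lemma Z_eq_sum_levelWeight (K : ℕ) (x r : ℝ) :
    Z K x r = ∑ n ∈ range (K + 1), levelWeight x r n :=
  sum_triangle_eq_sum_levels K fun k l => x ^ k * r ^ l / (Nat.factorial l : ℝ)

lemma sTilde_eq_levelWeight (K : ℕ) (x r : ℝ) :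
    sTilde K x r = (∑ n ∈ range (K + 1), (n : ℝ) * levelWeight x r n) /
      ∑ n ∈ range (K + 1), levelWeight x r n := by
  rw [sTilde, Z_eq_sum_levelWeight,
    sum_triangle_eq_sum_levels K
      fun k l => ((k : ℝ) + (l : ℝ)) * (x ^ k * r ^ l / (Nat.factorial l : ℝ))]
  congr 1
  refine sum_congr rfl fun n _ => ?_
  rw [levelWeight, mul_sum]
  refine sum_congr rfl fun l hl => ?_
  rw [Nat.cast_sub (by simpa [Nat.lt_succ_iff] using hl)]
  ring

lemma Z_eq_sum_truncExp (K : ℕ) (x r : ℝ) :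
    Z K x r = ∑ k ∈ range (K + 1), x ^ k * truncExp (K - k) r := by
  refine sum_congr rfl fun k hk => ?_
  rw [truncExp, mul_sum, show K + 1 - k = K - k + 1 by have := mem_range.1 hk; omega]
  exact sum_congr rfl fun l _ => by ring

lemma fEq_eq (K : ℕ) (a x r : ℝ) :
    fEq K a x r = (a - r) * Z K x r - a * truncExp K r := rfl

lemma levelWeight_one (r : ℝ) (n : ℕ) : levelWeight 1 r n = truncExp n r := by
  simp [levelWeight, truncExp]

lemma levelWeight_zero (x r : ℝ) : levelWeight x r 0 = 1 := by
  simp [levelWeight]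

lemma levelWeight_succ (x r : ℝ) (n : ℕ) :
    levelWeight x r (n + 1) =
      x * levelWeight x r n + r ^ (n + 1) / (Nat.factorial (n + 1) : ℝ) := by
  rw [levelWeight, sum_range_succ, levelWeight, mul_sum]
  simp only [Nat.sub_self, pow_zero, one_mul]
  congr 1
  refine sum_congr rfl fun l hl => ?_
  rw [show n + 1 - l = n - l + 1 by have := mem_range.1 hl; omega]
  ring

lemma levelWeight_succ' (x r : ℝ) (n : ℕ) :
    levelWeight x r (n + 1) = x ^ (n + 1) + r * ∑ l ∈ range (n + 1),
      (1 / ((l : ℝ) + 1)) * (x ^ (n - l) * r ^ l / (Nat.factorial l : ℝ)) := by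
  rw [levelWeight, sum_range_succ', mul_sum, add_comm]
  congr 1
  · simp
  · refine sum_congr rfl fun l _ => ?_
    rw [Nat.add_sub_add_right, Nat.factorial_succ]
    push_cast
    field_simp
    ring

lemma levelWeight_nonneg {x r : ℝ} (hx : 0 ≤ x) (hr : 0 ≤ r) (n : ℕ) :
    0 ≤ levelWeight x r n :=
  sum_nonneg fun _ _ => by positivity

lemma levelWeight_pos {x r : ℝ} (hx : 0 ≤ x) (hr : 0 < r) (n : ℕ) :
    0 < levelWeight x r n := by
  cases n with
  | zero => simp [levelWeight_zero]
  | succ n =>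
    rw [levelWeight_succ]
    have := levelWeight_nonneg hx hr.le n
    positivity

lemma one_le_truncExp (n : ℕ) {r : ℝ} (hr : 0 ≤ r) : 1 ≤ truncExp n r := by
  have := single_le_sum (f := fun l => r ^ l / (Nat.factorial l : ℝ))
    (fun _ _ => by positivity) (mem_range.2 n.succ_pos)
  simpa [truncExp] using this

lemma truncExp_le_Z (K : ℕ) {x r : ℝ} (hx : 0 ≤ x) (hr : 0 ≤ r) : truncExp K r ≤ Z K x r := by
  rw [Z_eq_sum_truncExp]
  have := single_le_sum (f := fun k => x ^ k * truncExp (K - k) r)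
    (fun k _ => mul_nonneg (pow_nonneg hx k) (zero_le_one.trans (one_le_truncExp _ hr)))
    (mem_range.2 K.succ_pos)
  simpa using this

lemma Z_pos (K : ℕ) {x r : ℝ} (hx : 0 ≤ x) (hr : 0 ≤ r) : 0 < Z K x r :=
  zero_lt_one.trans_le ((one_le_truncExp K hr).trans (truncExp_le_Z K hx hr))

lemma le_Z {K : ℕ} (hK : 1 ≤ K) {x r : ℝ} (hx : 0 ≤ x) (hr : 0 ≤ r) : x ≤ Z K x r := by
  rw [Z_eq_sum_truncExp]
  have := single_le_sum (f := fun k => x ^ k * truncExp (K - k) r)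
    (fun k _ => mul_nonneg (pow_nonneg hx k) (zero_le_one.trans (one_le_truncExp _ hr)))
    (mem_range.2 (Nat.lt_succ_of_le hK))
  simp only [pow_one] at this
  exact (le_mul_of_one_le_right hx (one_le_truncExp _ hr)).trans this

lemma Z_strictMonoOn {K : ℕ} (hK : 1 ≤ K) {r : ℝ} (hr : 0 ≤ r) :
    StrictMonoOn (fun x => Z K x r) (Set.Ici 0) := by
  intro x hx y _ hxy
  have hx : 0 ≤ x := hx
  simp only [Z_eq_sum_truncExp]
  have hE (n : ℕ) : 0 < truncExp n r := zero_lt_one.trans_le (one_le_truncExp n hr)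
  refine sum_lt_sum (fun k _ => ?_) ⟨1, mem_range.2 (Nat.lt_succ_of_le hK), ?_⟩
  · have := (hE (K - k)).le
    gcongr
  · simpa using mul_lt_mul_of_pos_right hxy (hE (K - 1))

lemma sum_sum_sub_mul_sub (N : ℕ) (g u v : ℕ → ℝ) :
    ∑ m ∈ range N, ∑ n ∈ range N, (g n - g m) * (v n * u m - v m * u n) =
      2 * ((∑ n ∈ range N, g n * v n) * ∑ n ∈ range N, u n -
        (∑ n ∈ range N, g n * u n) * ∑ n ∈ range N, v n) := by
  have expand (m n : ℕ) : (g n - g m) * (v n * u m - v m * u n) =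
      u m * (g n * v n) + (g m * v m) * u n - v m * (g n * u n) - (g m * u m) * v n := by ring
  simp only [expand, sum_sub_distrib, sum_add_distrib, ← mul_sum, ← sum_mul]
  ring

lemma levelWeight_succ_mul_le_of_le_right {x r r' : ℝ} (hx : 0 ≤ x) (hr : 0 ≤ r) (hrr : r ≤ r')
    (n : ℕ) : levelWeight x r (n + 1) * levelWeight x r' n ≤
      levelWeight x r' (n + 1) * levelWeight x r n := by
  have hr' := hr.trans hrr
  have key : r ^ (n + 1) * levelWeight x r' n ≤ r' ^ (n + 1) * levelWeight x r n := by
    simp only [levelWeight, mul_sum]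
    refine sum_le_sum fun l hl => ?_
    obtain ⟨d, hd⟩ : ∃ d, n + 1 = l + d := ⟨n + 1 - l, by have := mem_range.1 hl; omega⟩
    have h1 : r ^ d ≤ r' ^ d := pow_le_pow_left₀ hr hrr d
    calc r ^ (n + 1) * (x ^ (n - l) * r' ^ l / (Nat.factorial l : ℝ))
        = r ^ d * (r ^ l * r' ^ l * x ^ (n - l) / (Nat.factorial l : ℝ)) := by
          rw [hd, pow_add]; ring
      _ ≤ r' ^ d * (r ^ l * r' ^ l * x ^ (n - l) / (Nat.factorial l : ℝ)) := by gcongr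
      _ = r' ^ (n + 1) * (x ^ (n - l) * r ^ l / (Nat.factorial l : ℝ)) := by
          rw [hd, pow_add]; ring
  have key' := div_le_div_of_nonneg_right key (Nat.cast_nonneg (α := ℝ) (Nat.factorial (n + 1)))
  rw [levelWeight_succ, levelWeight_succ]
  rw [mul_div_right_comm, mul_div_right_comm] at key'
  linarith

lemma levelWeight_succ_mul_le_of_le_left {x x' r : ℝ} (hx : 0 ≤ x) (hxx : x ≤ x') (hr : 0 ≤ r)
    (n : ℕ) : levelWeight x r (n + 1) * levelWeight x' r n ≤
      levelWeight x' r (n + 1) * levelWeight x r n := by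
  have hx' := hx.trans hxx
  have h_pow : x ^ (n + 1) * levelWeight x' r n ≤ x' ^ (n + 1) * levelWeight x r n := by
    simp only [levelWeight, mul_sum]
    refine sum_le_sum fun l hl => ?_
    obtain ⟨d, hd⟩ : ∃ d, n + 1 = (n - l) + d := ⟨l + 1, by have := mem_range.1 hl; omega⟩
    have h1 : x ^ d ≤ x' ^ d := pow_le_pow_left₀ hx hxx d
    calc x ^ (n + 1) * (x' ^ (n - l) * r ^ l / (Nat.factorial l : ℝ))
        = x ^ d * (x ^ (n - l) * x' ^ (n - l) * r ^ l / (Nat.factorial l : ℝ)) := by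
          rw [hd, pow_add]; ring
      _ ≤ x' ^ d * (x ^ (n - l) * x' ^ (n - l) * r ^ l / (Nat.factorial l : ℝ)) := by gcongr
      _ = x' ^ (n + 1) * (x ^ (n - l) * r ^ l / (Nat.factorial l : ℝ)) := by
          rw [hd, pow_add]; ring
  let t (y : ℝ) (l : ℕ) : ℝ := y ^ (n - l) * r ^ l / (Nat.factorial l : ℝ)
  have ht {m l : ℕ} (hml : m ≤ l) (hl : l ≤ n) : t x' l * t x m ≤ t x' m * t x l := by
    obtain ⟨d, hd⟩ : ∃ d, n - m = (n - l) + d := ⟨l - m, by omega⟩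
    have h1 : x ^ d ≤ x' ^ d := pow_le_pow_left₀ hx hxx d
    calc t x' l * t x m = x ^ d * (x' ^ (n - l) * x ^ (n - l) *
          (r ^ l / (Nat.factorial l : ℝ)) * (r ^ m / (Nat.factorial m : ℝ))) := by
          simp only [t, hd, pow_add]; ring
      _ ≤ x' ^ d * (x' ^ (n - l) * x ^ (n - l) *
          (r ^ l / (Nat.factorial l : ℝ)) * (r ^ m / (Nat.factorial m : ℝ))) := by gcongr
      _ = t x' m * t x l := by simp only [t, hd, pow_add]; ring
  have hg {m l : ℕ} (hml : m ≤ l) : 1 / ((l : ℝ) + 1) ≤ 1 / ((m : ℝ) + 1) := by gcongr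
  have h_sum := sum_sum_sub_mul_sub (n + 1) (fun l => 1 / ((l : ℝ) + 1)) (t x) (t x')
  have h_nonneg : 0 ≤ ∑ m ∈ range (n + 1), ∑ l ∈ range (n + 1),
      (1 / ((l : ℝ) + 1) - 1 / ((m : ℝ) + 1)) * (t x' l * t x m - t x' m * t x l) := by
    refine sum_nonneg fun m hm => sum_nonneg fun l hl => ?_
    have hm := Nat.lt_succ_iff.1 (mem_range.1 hm)
    have hl := Nat.lt_succ_iff.1 (mem_range.1 hl)
    rcases le_total m l with h | h
    · exact mul_nonneg_of_nonpos_of_nonpos (sub_nonpos.2 (hg h)) (sub_nonpos.2 (ht h hl))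
    · exact mul_nonneg (sub_nonneg.2 (hg h)) (by linarith [ht h hm])
  rw [h_sum] at h_nonneg
  have h_tail := mul_le_mul_of_nonneg_left (sub_nonneg.1 (nonneg_of_mul_nonneg_right h_nonneg
    two_pos)) hr
  rw [levelWeight_succ', levelWeight_succ']
  change r * (_ * levelWeight x' r n) ≤ r * (_ * levelWeight x r n) at h_tail
  linarith

lemma mul_le_mul_of_succ_mul_le {u v : ℕ → ℝ} (hv : ∀ n, 0 < v n)
    (h : ∀ n, u (n + 1) * v n ≤ v (n + 1) * u n) {m n : ℕ} (hmn : m ≤ n) :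
    v m * u n ≤ v n * u m := by
  have anti : Antitone fun n => u n / v n := antitone_nat_of_succ_le fun n => by
    rw [div_le_div_iff₀ (hv _) (hv _)]
    linarith [h n]
  have := anti hmn
  rw [div_le_div_iff₀ (hv _) (hv _)] at this
  linarith

lemma sTilde_lt_of_succ_mul_le {K : ℕ} (hK : 1 ≤ K) {x r x' r' : ℝ} (hx : 0 ≤ x) (hr : 0 ≤ r)
    (hx' : 0 ≤ x') (hr' : 0 < r') (hlt : x + r < x' + r')
    (h : ∀ n, levelWeight x r (n + 1) * levelWeight x' r' n ≤
      levelWeight x' r' (n + 1) * levelWeight x r n) :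
    sTilde K x r < sTilde K x' r' := by
  have hZ := Z_pos K hx hr
  have hZ' := Z_pos K hx' hr'.le
  rw [Z_eq_sum_levelWeight] at hZ hZ'
  rw [sTilde_eq_levelWeight, sTilde_eq_levelWeight, div_lt_div_iff₀ hZ hZ', ← sub_pos]
  have h_sum := sum_sum_sub_mul_sub (K + 1) (fun n => (n : ℝ)) (levelWeight x r)
    (levelWeight x' r')
  have hmul {m n : ℕ} (hmn : m ≤ n) :=
    mul_le_mul_of_succ_mul_le (levelWeight_pos hx' hr') h hmn
  have h_term (m n : ℕ) : 0 ≤ ((n : ℝ) - m) * (levelWeight x' r' n * levelWeight x r m -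
      levelWeight x' r' m * levelWeight x r n) := by
    rcases le_total m n with hmn | hmn
    · exact mul_nonneg (sub_nonneg.2 (Nat.cast_le.2 hmn)) (sub_nonneg.2 (hmul hmn))
    · exact mul_nonneg_of_nonpos_of_nonpos (sub_nonpos.2 (Nat.cast_le.2 hmn))
        (sub_nonpos.2 (hmul hmn))
  have h_pos : 0 < ∑ m ∈ range (K + 1), ∑ n ∈ range (K + 1), ((n : ℝ) - m) *
      (levelWeight x' r' n * levelWeight x r m - levelWeight x' r' m * levelWeight x r n) := by
    refine sum_pos' (fun m _ => sum_nonneg fun n _ => h_term m n)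
      ⟨0, mem_range.2 K.succ_pos, sum_pos' (fun n _ => h_term 0 n)
        ⟨1, mem_range.2 (Nat.lt_succ_of_le hK), ?_⟩⟩
    have h_one (y q : ℝ) : levelWeight y q 1 = y + q := by
      simpa [levelWeight_zero] using levelWeight_succ y q 0
    rw [h_one, h_one, levelWeight_zero, levelWeight_zero]
    simpa using hlt
  rw [h_sum] at h_pos
  linarith

lemma sTilde_lt_sTilde {K : ℕ} (hK : 1 ≤ K) {x r x' r' : ℝ} (hx : 0 ≤ x) (hr : 0 ≤ r)
    (hxx : x < x') (hrr : r < r') : sTilde K x r < sTilde K x' r' :=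
  (sTilde_lt_of_succ_mul_le hK hx hr hx (hr.trans_lt hrr) (by linarith)
    (levelWeight_succ_mul_le_of_le_right hx hr hrr.le)).trans
  (sTilde_lt_of_succ_mul_le hK hx (hr.trans hrr.le) (hx.trans hxx.le) (hr.trans_lt hrr)
    (by linarith) (levelWeight_succ_mul_le_of_le_left hx hxx.le (hr.trans hrr.le)))

lemma Z_mul_truncExp_le (K : ℕ) {x r r' : ℝ} (hx : 0 ≤ x) (hr : 0 ≤ r) (hrr : r < r') :
    Z K x r' * truncExp K r ≤ Z K x r * truncExp K r' := by
  simp only [Z_eq_sum_truncExp, sum_mul]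
  refine sum_le_sum fun k _ => ?_
  have := mul_le_mul_of_succ_mul_le (levelWeight_pos zero_le_one (hr.trans_lt hrr))
    (levelWeight_succ_mul_le_of_le_right zero_le_one hr hrr.le) (K.sub_le k)
  simp only [levelWeight_one] at this
  calc x ^ k * truncExp (K - k) r' * truncExp K r
      = x ^ k * (truncExp (K - k) r' * truncExp K r) := by ring
    _ ≤ x ^ k * (truncExp K r' * truncExp (K - k) r) := by gcongr
    _ = x ^ k * truncExp (K - k) r * truncExp K r' := by ring

lemma lt_of_fEq_eq_zero {K : ℕ} (hK : 1 ≤ K) {a x r x' r' : ℝ} (hx' : 0 ≤ x')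
    (hr : 0 ≤ r) (hra : r' < a) (hrr : r < r') (hf : fEq K a x r = 0)
    (hf' : fEq K a x' r' = 0) : x < x' := by
  by_contra! hxx
  rw [fEq_eq, sub_eq_zero] at hf hf'
  have hr' := hr.trans hrr.le
  have hE := zero_lt_one.trans_le (one_le_truncExp K hr)
  have hE' := zero_lt_one.trans_le (one_le_truncExp K hr')
  have h1 : Z K x' r ≤ Z K x r :=
    (Z_strictMonoOn hK hr).monotoneOn hx' (hx'.trans hxx) hxx
  have h2 := Z_mul_truncExp_le K hx' hr hrr
  have hZ' := Z_pos K hx' hr'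
  have : a * truncExp K r' * truncExp K r < a * truncExp K r' * truncExp K r :=
    calc a * truncExp K r' * truncExp K r = (a - r') * (Z K x' r' * truncExp K r) := by
          rw [← hf']; ring
      _ < (a - r) * (Z K x' r' * truncExp K r) := by gcongr
      _ ≤ (a - r) * (Z K x' r * truncExp K r') :=
          mul_le_mul_of_nonneg_left h2 (by linarith)
      _ ≤ (a - r) * (Z K x r * truncExp K r') :=
          mul_le_mul_of_nonneg_left (mul_le_mul_of_nonneg_right h1 hE'.le) (by linarith)
      _ = a * truncExp K r' * truncExp K r := by rw [← mul_assoc, hf]; ring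
  exact this.false

lemma eq_of_fEq_eq_zero {K : ℕ} (hK : 1 ≤ K) {a x x' r : ℝ} (hx : 0 ≤ x) (hx' : 0 ≤ x')
    (hr : 0 ≤ r) (hra : r < a) (hf : fEq K a x r = 0) (hf' : fEq K a x' r = 0) : x = x' := by
  rw [fEq_eq, sub_eq_zero] at hf hf'
  exact (Z_strictMonoOn hK hr).injOn hx hx'
    (mul_left_cancel₀ (sub_pos.2 hra).ne' (hf.trans hf'.symm))

lemma continuous_Z (K : ℕ) : Continuous fun p : ℝ × ℝ => Z K p.1 p.2 := by
  unfold Z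
  fun_prop

lemma continuous_fEq (K : ℕ) (a : ℝ) : Continuous fun p : ℝ × ℝ => fEq K a p.1 p.2 := by
  have := continuous_Z K
  unfold fEq
  fun_prop

lemma exists_fEq_eq_zero_left {K : ℕ} (hK : 1 ≤ K) {a r : ℝ} (hr : 0 ≤ r) (hra : r < a) :
    ∃ x, 0 ≤ x ∧ fEq K a x r = 0 := by
  have ha := hr.trans_lt hra
  have har := sub_pos.2 hra
  have hE := zero_lt_one.trans_le (one_le_truncExp K hr)
  have hM : 0 ≤ a * truncExp K r / (a - r) := by positivity
  have hcont : Continuous fun x => fEq K a x r :=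
    (continuous_fEq K a).comp (by fun_prop : Continuous fun x : ℝ => (x, r))
  have hlow : fEq K a 0 r ≤ 0 := by
    have hZ : Z K 0 r = truncExp K r := by
      rw [Z_eq_sum_truncExp, sum_range_succ']
      simp
    rw [fEq_eq, hZ]
    linarith [mul_nonneg hr hE.le]
  have hhigh : 0 ≤ fEq K a (a * truncExp K r / (a - r)) r := by
    rw [fEq_eq, sub_nonneg]
    have := le_Z hK hM hr
    rwa [div_le_iff₀' har] at this
  obtain ⟨x, hx, hfx⟩ := intermediate_value_Icc hM hcont.continuousOn ⟨hlow, hhigh⟩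
  exact ⟨x, hx.1, hfx⟩

lemma exists_fEq_eq_zero_right (K : ℕ) {a x : ℝ} (ha : 0 < a) (hx : 0 ≤ x) :
    ∃ r, 0 ≤ r ∧ r < a ∧ fEq K a x r = 0 := by
  have hcont : Continuous fun r => fEq K a x r :=
    (continuous_fEq K a).comp (by fun_prop : Continuous fun r : ℝ => (x, r))
  have hfa : fEq K a x a < 0 := by
    rw [fEq_eq]
    have := zero_lt_one.trans_le (one_le_truncExp K ha.le)
    simp only [sub_self, zero_mul, zero_sub, neg_lt_zero]
    positivity
  have hf0 : 0 ≤ fEq K a x 0 := by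
    rw [fEq_eq, sub_zero, ← mul_sub]
    exact mul_nonneg ha.le (sub_nonneg.2 (truncExp_le_Z K hx le_rfl))
  obtain ⟨r, hr, hfr⟩ := intermediate_value_Icc' ha.le hcont.continuousOn ⟨hfa.le, hf0⟩
  refine ⟨r, hr.1, hr.2.lt_of_ne ?_, hfr⟩
  rintro rfl
  exact hfa.ne hfr

lemma sub_sTilde_le (K : ℕ) {x r : ℝ} (hx : 1 ≤ x) (hr : 0 ≤ r) :
    K - sTilde K x r ≤ K * (K + 1) / x := by
  have hx0 : 0 < x := zero_lt_one.trans_le hx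
  have hZ := Z_pos K hx0.le hr
  have hstep (n : ℕ) : x * levelWeight x r n ≤ levelWeight x r (n + 1) := by
    rw [levelWeight_succ]
    have : 0 ≤ r ^ (n + 1) / (Nat.factorial (n + 1) : ℝ) := by positivity
    linarith
  have hmono : Monotone (levelWeight x r) := monotone_nat_of_le_succ fun n =>
    (le_mul_of_one_le_left (levelWeight_nonneg hx0.le hr n) hx).trans (hstep n)
  have htop : levelWeight x r K ≤ Z K x r := by
    rw [Z_eq_sum_levelWeight]
    exact single_le_sum (fun n _ => levelWeight_nonneg hx0.le hr n) (self_mem_range_succ K)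
  have hterm : ∀ n ∈ range (K + 1), ((K : ℝ) - n) * (x * levelWeight x r n) ≤ K * Z K x r := by
    intro n hn
    have hnK : n ≤ K := Nat.lt_succ_iff.1 (mem_range.1 hn)
    rcases hnK.eq_or_lt with rfl | hlt
    · simpa using mul_nonneg (Nat.cast_nonneg n) hZ.le
    · have h1 : x * levelWeight x r n ≤ Z K x r := (hstep n).trans ((hmono hlt).trans htop)
      have h2 := levelWeight_nonneg hx0.le hr n
      exact mul_le_mul (by simp) h1 (by positivity) (Nat.cast_nonneg K)
  have hsum := sum_le_sum hterm
  rw [sum_const, card_range, nsmul_eq_mul] at hsum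
  have heq : (K - sTilde K x r) * Z K x r * x =
      ∑ n ∈ range (K + 1), ((K : ℝ) - n) * (x * levelWeight x r n) := by
    have : sTilde K x r * Z K x r = ∑ n ∈ range (K + 1), (n : ℝ) * levelWeight x r n := by
      rw [sTilde_eq_levelWeight, ← Z_eq_sum_levelWeight, div_mul_cancel₀ _ hZ.ne']
    rw [sub_mul, this, Z_eq_sum_levelWeight, mul_sum, ← sum_sub_distrib, sum_mul]
    exact sum_congr rfl fun n _ => by ring
  rw [le_div_iff₀ hx0]
  refine le_of_mul_le_mul_right ?_ hZ
  push_cast at hsum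
  linarith

lemma sTilde_zero (K : ℕ) : sTilde K 0 0 = 0 := by
  rw [sTilde_eq_levelWeight, sum_eq_zero, zero_div]
  intro n _
  cases n with
  | zero => simp
  | succ n => simp [levelWeight_succ']

lemma exists_fEq_eq_zero_sTilde_eq {K : ℕ} (hK : 1 ≤ K) {a s : ℝ} (ha : 0 < a) (hs0 : 0 < s)
    (hsK : s < K) : ∃ x r, 0 ≤ x ∧ 0 ≤ r ∧ r < a ∧ fEq K a x r = 0 ∧ sTilde K x r = s := by
  choose X hX0 hXf using fun r : Set.Ico 0 a => exists_fEq_eq_zero_left hK r.2.1 r.2.2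
  let φ (r : Set.Ico 0 a) : Set.Ici (0 : ℝ) := ⟨X r, hX0 r⟩
  have hφ : StrictMono φ := fun r r' h =>
    lt_of_fEq_eq_zero hK (hX0 r') r.2.1 r'.2.2 h (hXf r) (hXf r')
  have hφ_eq {x r : ℝ} (hx : 0 ≤ x) (hr : 0 ≤ r) (hra : r < a) (hf : fEq K a x r = 0) :
      φ ⟨r, hr, hra⟩ = ⟨x, hx⟩ :=
    Subtype.ext (eq_of_fEq_eq_zero hK (hX0 _) hx hr hra (hXf ⟨r, hr, hra⟩) hf)
  have hφ_surj : Function.Surjective φ := fun ⟨x, hx⟩ =>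
    let ⟨_, hr, hra, hf⟩ := exists_fEq_eq_zero_right K ha hx
    ⟨_, hφ_eq hx hr hra hf⟩
  have hφ_cont : Continuous φ := (hφ.orderIsoOfSurjective φ hφ_surj).continuous
  have hX : Continuous X := continuous_subtype_val.comp hφ_cont
  have hcont : Continuous fun r : Set.Ico 0 a => sTilde K (X r) r := by
    have hpair : Continuous fun r : Set.Ico 0 a => (X r, (r : ℝ)) := by fun_prop
    have hZ : Continuous fun r : Set.Ico 0 a => Z K (X r) r := (continuous_Z K).comp hpair
    unfold sTilde
    exact Continuous.div (by fun_prop) hZ fun r => (Z_pos K (hX0 r) r.2.1).ne'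
  have : PreconnectedSpace (Set.Ico 0 a) :=
    Subtype.preconnectedSpace isPreconnected_Ico
  have hlow : sTilde K (X ⟨0, le_rfl, ha⟩) 0 ≤ s := by
    have h0 : fEq K a 0 0 = 0 := by simp [fEq_eq, Z_eq_sum_truncExp, sum_range_succ', truncExp]
    rw [show X ⟨0, le_rfl, ha⟩ = 0 from congrArg Subtype.val (hφ_eq le_rfl le_rfl ha h0),
      sTilde_zero]
    exact hs0.le
  obtain ⟨⟨x, hx0⟩, hx1, hxs⟩ : ∃ x : Set.Ici (0 : ℝ), 1 ≤ (x : ℝ) ∧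
      (K : ℝ) * (K + 1) / x ≤ K - s := by
    have hd := sub_pos.2 hsK
    have hpos : 0 < max 1 ((K : ℝ) * (K + 1) / (K - s)) := by positivity
    refine ⟨⟨_, hpos.le⟩, le_max_left _ _, ?_⟩
    rw [div_le_iff₀ hpos, ← div_le_iff₀' hd]
    exact le_max_right _ _
  obtain ⟨r₁, hr₁⟩ := hφ_surj ⟨x, hx0⟩
  have hhigh : s ≤ sTilde K (X r₁) r₁ := by
    rw [show X r₁ = x from congrArg Subtype.val hr₁]
    linarith [sub_sTilde_le K hx1 r₁.2.1]
  obtain ⟨r, hr⟩ := mem_range_of_exists_le_of_exists_ge hcont ⟨_, hlow⟩ ⟨_, hhigh⟩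
  exact ⟨X r, r, hX0 r, r.2.1, r.2.2, hXf r, hr⟩

/-- For 0 < s < K there is exactly one pair (x, r) with x ≥ 0, 0 ≤ r < a,
f(x,r) = 0 and sTilde(x,r) = s. -/
theorem stmt_10 (K : ℕ) (hK : 1 ≤ K) (a : ℝ) (ha : 0 < a)
    (s : ℝ) (hs0 : 0 < s) (hsK : s < (K : ℝ)) :
    ∃! p : ℝ × ℝ, 0 ≤ p.1 ∧ 0 ≤ p.2 ∧ p.2 < a ∧
      fEq K a p.1 p.2 = 0 ∧ sTilde K p.1 p.2 = s := by
  obtain ⟨x, r, hx, hr, hra, hf, hs⟩ := exists_fEq_eq_zero_sTilde_eq hK ha hs0 hsK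
  refine ⟨(x, r), ⟨hx, hr, hra, hf, hs⟩, ?_⟩
  rintro ⟨x', r'⟩ ⟨hx', hr', hra', hf', hs'⟩
  rcases lt_trichotomy r r' with h | rfl | h
  · exact absurd (hs.trans hs'.symm)
      (sTilde_lt_sTilde hK hx hr (lt_of_fEq_eq_zero hK hx' hr hra' h hf hf') h).ne
  · exact Prod.ext (eq_of_fEq_eq_zero hK hx' hx hr hra hf' hf) rfl
  · exact absurd (hs'.trans hs.symm)
      (sTilde_lt_sTilde hK hx' hr' (lt_of_fEq_eq_zero hK hx hr' hra h hf' hf) h).ne
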